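/- arXiv:math/0009205 — 10 statements merged into one kernel-verified Lean document; each statement's English description precedes it below -/
import Mathlib

section
/- For all pairwise distinct complex numbers a, b, c, the set {z ∈ ℂ : z ∉ {a, b, c} and (Im χ(a,b,c,z) < 0 or Im χ(a,c,b,z) < 0)} is open and dense in ℂ. (This is property (ii) of the disks D(a,b,c) = {z : Im χ(a,b,c,z) < 0}: the union D(a,b,c) ∪ D(a,c,b) is dense.) -/
/-- The cross-ratio of four complex numbers, normalised so that `χ(0,1,∞,z) = z`,
i.e. the image of `d` under the Möbius map sending `a ↦ 0`, `b ↦ 1`, `c ↦ ∞`. -/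
noncomputable def crossRatio (a b c d : ℂ) : ℂ :=
  ((d - a) * (b - c)) / ((d - c) * (b - a))

/-- The real polynomial in `z` whose sign is that of the imaginary part of the cross-ratio. -/
def crossRatioForm (a b c z : ℂ) : ℝ :=
  (((z - a) * (b - c)) * (starRingEnd ℂ) ((z - c) * (b - a))).im

lemma continuous_crossRatioForm (a b c : ℂ) : Continuous (crossRatioForm a b c) := by
  unfold crossRatioForm
  fun_prop

lemma crossRatioForm_swap (a b c z : ℂ) : crossRatioForm a c b z = -crossRatioForm a b c z := by
  simp only [crossRatioForm, map_mul, map_sub, Complex.mul_im, Complex.mul_re, Complex.sub_im,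
    Complex.sub_re, Complex.conj_re, Complex.conj_im]
  ring

lemma crossRatio_im (a b c z : ℂ) :
    (crossRatio a b c z).im = crossRatioForm a b c z / Complex.normSq ((z - c) * (b - a)) := by
  rw [crossRatio, crossRatioForm, div_eq_mul_inv, Complex.inv_def, ← mul_assoc,
    Complex.im_mul_ofReal, div_eq_mul_inv]

lemma crossRatio_im_neg_iff {a b c z : ℂ} (hab : a ≠ b) (hz : z ≠ c) :
    (crossRatio a b c z).im < 0 ↔ crossRatioForm a b c z < 0 := by
  have h : 0 < Complex.normSq ((z - c) * (b - a)) :=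
    Complex.normSq_pos.2 (mul_ne_zero (sub_ne_zero.2 hz) (sub_ne_zero.2 hab.symm))
  rw [crossRatio_im, div_lt_iff₀ h, zero_mul]

lemma crossRatioForm_eq (a b c z : ℂ) :
    crossRatioForm a b c z =
      ((b - c) * (starRingEnd ℂ) (b - a)).im *
        ((z.re - a.re) * (z.re - c.re) + (z.im - a.im) * (z.im - c.im)) +
      ((b - c) * (starRingEnd ℂ) (b - a)).re *
        ((z.im - a.im) * (z.re - c.re) - (z.re - a.re) * (z.im - c.im)) := by
  simp only [crossRatioForm, map_mul, map_sub, Complex.mul_im, Complex.mul_re, Complex.sub_im,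
    Complex.sub_re, Complex.conj_re, Complex.conj_im]
  ring

lemma setOf_crossRatio_im_neg_eq {a b c : ℂ} (hab : a ≠ b) (hac : a ≠ c) :
    {z : ℂ | z ≠ a ∧ z ≠ b ∧ z ≠ c ∧
        ((crossRatio a b c z).im < 0 ∨ (crossRatio a c b z).im < 0)} =
      {z : ℂ | crossRatioForm a b c z ≠ 0} := by
  ext z
  simp only [Set.mem_ofPred_eq]
  constructor
  · rintro ⟨-, hb, hc, h⟩
    rw [crossRatio_im_neg_iff hab hc, crossRatio_im_neg_iff hac hb, crossRatioForm_swap a b c,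
      neg_lt_zero] at h
    exact h.elim ne_of_lt ne_of_gt
  · intro h
    have hb : z ≠ b := by
      rintro rfl
      rw [← neg_ne_zero, ← crossRatioForm_swap] at h
      simp [crossRatioForm] at h
    have hc : z ≠ c := by
      rintro rfl
      simp [crossRatioForm] at h
    refine ⟨?_, hb, hc, ?_⟩
    · rintro rfl
      simp [crossRatioForm] at h
    · rw [crossRatio_im_neg_iff hab hc, crossRatio_im_neg_iff hac hb, crossRatioForm_swap a b c,
        neg_lt_zero]
      exact lt_or_gt_of_ne h

lemma dense_crossRatioForm_ne_zero {a b c : ℂ} (hab : a ≠ b) (hac : a ≠ c) (hbc : b ≠ c) :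
    Dense {z : ℂ | crossRatioForm a b c z ≠ 0} := by
  rw [Metric.dense_iff]
  intro z ε hε
  by_contra hne
  have hzero (w : ℂ) (hw : ‖w‖ < ε) : crossRatioForm a b c (z + w) = 0 := by
    by_contra h
    exact hne ⟨z + w, by simpa using hw, h⟩
  have ht : 0 < ε / 2 := half_pos hε
  have hnorm : ‖((ε / 2 : ℝ) : ℂ)‖ < ε := by
    rw [Complex.norm_real, Real.norm_of_nonneg ht.le]
    exact half_lt_self hε
  have h₀ := hzero 0 (by simpa using hε)
  have h₁ := hzero (ε / 2 : ℝ) hnorm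
  have h₂ := hzero (-(ε / 2 : ℝ)) (by rwa [norm_neg])
  have h₃ := hzero ((ε / 2 : ℝ) * Complex.I) (by rwa [norm_mul, Complex.norm_I, mul_one])
  have hprod : (b - c) * (starRingEnd ℂ) (b - a) ≠ 0 :=
    mul_ne_zero (sub_ne_zero.2 hbc) ((map_ne_zero _).2 (sub_ne_zero.2 hab.symm))
  rw [crossRatioForm_eq] at h₀ h₁ h₂ h₃
  generalize (b - c) * (starRingEnd ℂ) (b - a) = p at *
  generalize ε / 2 = t at *
  simp only [Complex.add_re, Complex.add_im, Complex.neg_re, Complex.neg_im, Complex.ofReal_re,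
    Complex.ofReal_im, Complex.re_ofReal_mul, Complex.im_ofReal_mul, Complex.I_re, Complex.I_im,
    Complex.zero_re, Complex.zero_im] at h₀ h₁ h₂ h₃
  have him : p.im = 0 := by
    have h : p.im * t ^ 2 = 0 := by linear_combination (h₁ + h₂ - 2 * h₀) / 2
    exact (mul_eq_zero.1 h).resolve_right (pow_ne_zero 2 ht.ne')
  have hre : p.re ≠ 0 := fun h => hprod (Complex.ext h him)
  rw [him] at h₀ h₁ h₃
  have hpt : p.re * t ≠ 0 := mul_ne_zero hre ht.ne'
  apply hac
  apply Complex.ext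
  · have h : p.re * t * (a.re - c.re) = 0 := by linear_combination h₃ - h₀
    exact sub_eq_zero.1 ((mul_eq_zero.1 h).resolve_left hpt)
  · have h : p.re * t * (a.im - c.im) = 0 := by linear_combination h₀ - h₁
    exact sub_eq_zero.1 ((mul_eq_zero.1 h).resolve_left hpt)

/-- For pairwise distinct `a b c : ℂ`, the union `D(a,b,c) ∪ D(a,c,b)` of the two
disks determined by the sign of the imaginary part of the cross-ratio is open and
dense in `ℂ`. -/
theorem disk_union_open_dense (a b c : ℂ) (hab : a ≠ b) (hac : a ≠ c) (hbc : b ≠ c) :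
    IsOpen {z : ℂ | z ≠ a ∧ z ≠ b ∧ z ≠ c ∧
        ((crossRatio a b c z).im < 0 ∨ (crossRatio a c b z).im < 0)} ∧
    Dense {z : ℂ | z ≠ a ∧ z ≠ b ∧ z ≠ c ∧
        ((crossRatio a b c z).im < 0 ∨ (crossRatio a c b z).im < 0)} := by
  rw [setOf_crossRatio_im_neg_eq hab hac]
  exact ⟨isOpen_ne_fun (continuous_crossRatioForm a b c) continuous_const,
    dense_crossRatioForm_ne_zero hab hac hbc⟩
end

section
/- (Reversal rule.) If (a,b,c) ∈ O₃, (u,v,w) ∈ O₃ and (a,b,c) ⇝ᵖ (u,v,w), then (w,u,v) ⇝ᵖ (b,c,a). -/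
open Topology

/-- The set of triples of pairwise distinct points of `W`. -/
def O3 (W : Type*) : Set (W × W × W) :=
  {t | t.1 ≠ t.2.1 ∧ t.1 ≠ t.2.2 ∧ t.2.1 ≠ t.2.2}

/-- The set of quadruples `(a,b,c,d)` with `(a,b,c) ∈ O₃` and `d ∈ D(a,b,c)`. -/
def O4 {W : Type*} (D : W → W → W → Set W) : Set (W × W × W × W) :=
  {q | (q.1, q.2.1, q.2.2.1) ∈ O3 W ∧ q.2.2.2 ∈ D q.1 q.2.1 q.2.2.1}

/-- The initial triple `(q¹, q², q³)` of a quadruple. -/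
def tri1 {W : Type*} (q : W × W × W × W) : W × W × W := (q.1, q.2.1, q.2.2.1)

/-- The final triple `(q³, q², q⁴)` of a quadruple. -/
def tri2 {W : Type*} (q : W × W × W × W) : W × W × W := (q.2.2.1, q.2.1, q.2.2.2)

/-- The triple `(q², q⁴, q³)` of a quadruple, one of the two admissible transitions. -/
def stepA {W : Type*} (q : W × W × W × W) : W × W × W := (q.2.1, q.2.2.2, q.2.2.1)

/-- The triple `(q³, q², q⁴)` of a quadruple, the other admissible transition. -/
def stepB {W : Type*} (q : W × W × W × W) : W × W × W := (q.2.2.1, q.2.1, q.2.2.2)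

/-- `Leads Q p t t'` (written `t ⇝ᵖ t'` in the paper): there is a chain `q₁, …, q_j`
of at most `p` quadruples of `Q` with `(q₁¹,q₁²,q₁³) = t`, `(q_j³,q_j²,q_j⁴) = t'`, and
consecutive quadruples related by one of the two admissible transitions. -/
def Leads {W : Type*} (Q : Set (W × W × W × W)) (p : ℕ) (t t' : W × W × W) : Prop :=
  ∃ j : ℕ, 1 ≤ j ∧ j ≤ p ∧ ∃ q : ℕ → W × W × W × W,
    (∀ n < j, q n ∈ Q) ∧ tri1 (q 0) = t ∧ tri2 (q (j - 1)) = t' ∧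
    ∀ n, n + 1 < j →
      tri1 (q (n + 1)) = stepA (q n) ∨ tri1 (q (n + 1)) = stepB (q n)

/-- The quadruple `(d,c,b,a)` obtained by reversing `(a,b,c,d)`. -/
def quadRev {W : Type*} (q : W × W × W × W) : W × W × W × W :=
  (q.2.2.2, q.2.2.1, q.2.1, q.1)

theorem tri1_quadRev_of_tri2_eq {W : Type*} {q : W × W × W × W} {u v w : W}
    (h : tri2 q = (u, v, w)) : tri1 (quadRev q) = (w, u, v) := by
  simp only [tri2, Prod.mk.injEq] at h
  simp [tri1, quadRev, h]

theorem tri2_quadRev_of_tri1_eq {W : Type*} {q : W × W × W × W} {a b c : W}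
    (h : tri1 q = (a, b, c)) : tri2 (quadRev q) = (b, c, a) := by
  simp only [tri1, Prod.mk.injEq] at h
  simp [tri2, quadRev, h]

/-- Reversal exchanges the two admissible transitions. -/
theorem tri1_quadRev_of_step {W : Type*} {q r : W × W × W × W}
    (h : tri1 r = stepA q ∨ tri1 r = stepB q) :
    tri1 (quadRev q) = stepA (quadRev r) ∨ tri1 (quadRev q) = stepB (quadRev r) := by
  rcases h with h | h
  · right
    simp only [tri1, stepA, Prod.mk.injEq] at h
    simp [tri1, stepB, quadRev, h]
  · left
    simp only [tri1, stepB, Prod.mk.injEq] at h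
    simp [tri1, stepA, quadRev, h]

/-- Reversal rule: if `(a,b,c) ⇝ᵖ (u,v,w)` then `(w,u,v) ⇝ᵖ (b,c,a)`. -/
theorem leads_reversal {W : Type*} [MetricSpace W] (D : W → W → W → Set W)
    (h2 : ∀ a b c : W, (a, b, c) ∈ O3 W → Dense (D a b c ∪ D a c b))
    (h3 : ∀ a b c : W, (a, b, c) ∈ O3 W → a ∈ closure (D a b c))
    (h4open : IsOpen (O4 D))
    (h4dist : ∀ a b c d : W, (a, b, c, d) ∈ O4 D →
      a ≠ b ∧ a ≠ c ∧ a ≠ d ∧ b ≠ c ∧ b ≠ d ∧ c ≠ d)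
    (h4rev : ∀ a b c d : W, (a, b, c, d) ∈ O4 D → (d, c, b, a) ∈ O4 D)
    (a b c u v w : W) (ht : (a, b, c) ∈ O3 W) (ht' : (u, v, w) ∈ O3 W) (p : ℕ)
    (h : Leads (O4 D) p (a, b, c) (u, v, w)) :
    Leads (O4 D) p (w, u, v) (b, c, a) := by
  obtain ⟨j, hj, hjp, q, hq, hfirst, hlast, hstep⟩ := h
  refine ⟨j, hj, hjp, fun n => quadRev (q (j - 1 - n)), fun n hn => ?_,
    tri1_quadRev_of_tri2_eq hlast, ?_, fun n hn => ?_⟩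
  · exact h4rev _ _ _ _ (hq (j - 1 - n) (by omega))
  · simpa using tri2_quadRev_of_tri1_eq hfirst
  · have hs := hstep (j - 1 - (n + 1)) (by omega)
    rw [show j - 1 - (n + 1) + 1 = j - 1 - n by omega] at hs
    exact tri1_quadRev_of_step hs
end

section
/- (Step 1.) For every (a,b,c) ∈ O₃ and every neighborhood V of (a,b,c) in W³, there exists (a₁,b₁,c₁) ∈ O₃ ∩ V such that (a,b,c) ⇝³ (a₁,c₁,b₁). -/
open Topology

/-- Step 1: for every `(a,b,c) ∈ O₃` there exist `(a₁,b₁,c₁)` arbitrarily close to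
`(a,b,c)` with `(a,b,c) ⇝³ (a₁,c₁,b₁)`. -/
theorem leads_step1 {W : Type*} [MetricSpace W] (D : W → W → W → Set W)
    (h2 : ∀ a b c : W, (a, b, c) ∈ O3 W → Dense (D a b c ∪ D a c b))
    (h3 : ∀ a b c : W, (a, b, c) ∈ O3 W → a ∈ closure (D a b c))
    (h4open : IsOpen (O4 D))
    (h4dist : ∀ a b c d : W, (a, b, c, d) ∈ O4 D →
      a ≠ b ∧ a ≠ c ∧ a ≠ d ∧ b ≠ c ∧ b ≠ d ∧ c ≠ d)
    (h4rev : ∀ a b c d : W, (a, b, c, d) ∈ O4 D → (d, c, b, a) ∈ O4 D)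
    (a b c : W) (habc : (a, b, c) ∈ O3 W)
    (V : Set (W × W × W)) (hV : V ∈ 𝓝 ((a, b, c) : W × W × W)) :
    ∃ a₁ b₁ c₁ : W, (a₁, b₁, c₁) ∈ O3 W ∧ (a₁, b₁, c₁) ∈ V ∧
      Leads (O4 D) 3 (a, b, c) (a₁, c₁, b₁) := by
  obtain ⟨U₁, hU₁, V', hV', hUV⟩ := mem_nhds_prod_iff.1 hV
  obtain ⟨U₂, hU₂, U₃, hU₃, hU₂₃⟩ := mem_nhds_prod_iff.1 hV'
  have mem_O4 : ∀ {x y z w : W}, (x, y, z) ∈ O3 W → w ∈ D x y z → (x, y, z, w) ∈ O4 D :=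
    fun h hw => ⟨h, hw⟩
  obtain ⟨d, hdU, hd⟩ := mem_closure_iff_nhds.1 (h3 a b c habc) U₁ hU₁
  have hq₁ := mem_O4 habc hd
  obtain ⟨-, -, -, hbc, hbd, hcd⟩ := h4dist _ _ _ _ hq₁
  have hcbd : (c, b, d) ∈ O3 W := ⟨hbc.symm, hcd, hbd⟩
  obtain ⟨e, heU, he⟩ := mem_closure_iff_nhds.1 (h3 c b d hcbd) U₃ hU₃
  have hq₂ := mem_O4 hcbd he
  obtain ⟨-, -, -, -, hbe, hde⟩ := h4dist _ _ _ _ hq₂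
  have hbed : (b, e, d) ∈ O3 W := ⟨hbe, hbd, hde.symm⟩
  obtain ⟨f, hfU, hf⟩ := mem_closure_iff_nhds.1 (h3 b e d hbed) U₂ hU₂
  have hq₃ := mem_O4 hbed hf
  obtain ⟨-, -, -, -, hef, hdf⟩ := h4dist _ _ _ _ hq₃
  refine ⟨d, f, e, ⟨hdf, hde, hef.symm⟩, hUV ⟨hdU, hU₂₃ ⟨hfU, heU⟩⟩, 3, by norm_num, le_rfl,
    fun n => if n = 0 then (a, b, c, d) else if n = 1 then (c, b, d, e) else (b, e, d, f),
    ?_, rfl, rfl, ?_⟩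
  · intro n hn
    interval_cases n
    · exact hq₁
    · exact hq₂
    · exact hq₃
  · intro n hn
    have hn' : n < 2 := by omega
    interval_cases n
    · exact Or.inr rfl
    · exact Or.inl rfl
end

section
/- (Step 2.) For every (a,b,c) ∈ O₃ and every neighborhood V of (a,b,c) in W³, there exists (a₁,b₁,c₁) ∈ O₃ ∩ V such that (a,b,c) ⇝³ (b₁,a₁,c₁). -/
open Topology

/-- Step 2: for every `(a,b,c) ∈ O₃` there exist `(a₁,b₁,c₁)` arbitrarily close to
`(a,b,c)` with `(a,b,c) ⇝³ (b₁,a₁,c₁)`. -/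
theorem leads_step2 {W : Type*} [MetricSpace W] (D : W → W → W → Set W)
    (h2 : ∀ a b c : W, (a, b, c) ∈ O3 W → Dense (D a b c ∪ D a c b))
    (h3 : ∀ a b c : W, (a, b, c) ∈ O3 W → a ∈ closure (D a b c))
    (h4open : IsOpen (O4 D))
    (h4dist : ∀ a b c d : W, (a, b, c, d) ∈ O4 D →
      a ≠ b ∧ a ≠ c ∧ a ≠ d ∧ b ≠ c ∧ b ≠ d ∧ c ≠ d)
    (h4rev : ∀ a b c d : W, (a, b, c, d) ∈ O4 D → (d, c, b, a) ∈ O4 D)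
    (a b c : W) (habc : (a, b, c) ∈ O3 W)
    (V : Set (W × W × W)) (hV : V ∈ 𝓝 ((a, b, c) : W × W × W)) :
    ∃ a₁ b₁ c₁ : W, (a₁, b₁, c₁) ∈ O3 W ∧ (a₁, b₁, c₁) ∈ V ∧
      Leads (O4 D) 3 (a, b, c) (b₁, a₁, c₁) := by
  obtain ⟨Va, hVa, Vbc, hVbc, hsub⟩ := mem_nhds_prod_iff.1 hV
  obtain ⟨Vb, hVb, Vc, hVc, hsub'⟩ := mem_nhds_prod_iff.1 hVbc
  obtain ⟨a₁, ha₁, hDa⟩ := mem_closure_iff_nhds.1 (h3 a b c habc) Va hVa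
  have hq₀ : (a, b, c, a₁) ∈ O4 D := ⟨habc, hDa⟩
  obtain ⟨-, -, -, hbc, hba, hca⟩ := h4dist _ _ _ _ hq₀
  have hbac : (b, a₁, c) ∈ O3 W := ⟨hba, hbc, hca.symm⟩
  obtain ⟨b₁, hb₁, hDb⟩ := mem_closure_iff_nhds.1 (h3 b a₁ c hbac) Vb hVb
  have hq₁ : (b, a₁, c, b₁) ∈ O4 D := ⟨hbac, hDb⟩
  obtain ⟨-, -, -, -, hab₁, hcb₁⟩ := h4dist _ _ _ _ hq₁
  have hcab : (c, a₁, b₁) ∈ O3 W := ⟨hca, hcb₁, hab₁⟩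
  obtain ⟨c₁, hc₁, hDc⟩ := mem_closure_iff_nhds.1 (h3 c a₁ b₁ hcab) Vc hVc
  have hq₂ : (c, a₁, b₁, c₁) ∈ O4 D := ⟨hcab, hDc⟩
  obtain ⟨-, -, -, -, hac₁, hbc₁⟩ := h4dist _ _ _ _ hq₂
  refine ⟨a₁, b₁, c₁, ⟨hab₁, hac₁, hbc₁⟩, hsub ⟨ha₁, hsub' ⟨hb₁, hc₁⟩⟩, 3, by norm_num,
    le_rfl, fun n => match n with
      | 0 => (a, b, c, a₁)
      | 1 => (b, a₁, c, b₁)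
      | _ => (c, a₁, b₁, c₁), ?_, rfl, rfl, ?_⟩
  · intro n hn
    interval_cases n
    exacts [hq₀, hq₁, hq₂]
  · intro n hn
    have hn' : n < 2 := by omega
    interval_cases n
    exacts [Or.inl rfl, Or.inr rfl]
end

section
/- (Step 3.) For every (a,b,c) ∈ O₃ there exists a neighborhood V of (a,b,c) in W³ such that every (a₁,b₁,c₁) ∈ O₃ ∩ V satisfies (a,b,c) ⇝³⁶ (a₁,b₁,c₁); in particular (a,b,c) ⇝³⁶ (a,b,c). -/
open Topology

theorem Leads.single {W : Type*} {Q : Set (W × W × W × W)} {x y z w : W}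
    (h : (x, y, z, w) ∈ Q) : Leads Q 1 (x, y, z) (z, y, w) :=
  ⟨1, le_rfl, le_rfl, fun _ => (x, y, z, w), fun _ _ => h, rfl, rfl, fun n hn => by omega⟩

theorem Leads.mono {W : Type*} {Q : Set (W × W × W × W)} {p p' : ℕ} {t t' : W × W × W}
    (h : Leads Q p t t') (hp : p ≤ p') : Leads Q p' t t' := by
  obtain ⟨j, h1, hj, q, hq⟩ := h
  exact ⟨j, h1, hj.trans hp, q, hq⟩

theorem Leads.cons {W : Type*} {Q : Set (W × W × W × W)} {p : ℕ} {q₀ : W × W × W × W}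
    {s t' : W × W × W} (h₀ : q₀ ∈ Q) (hs : s = stepA q₀ ∨ s = stepB q₀)
    (h : Leads Q p s t') : Leads Q (p + 1) (tri1 q₀) t' := by
  obtain ⟨j, h1, hj, q, hQ, hstart, hend, hstep⟩ := h
  refine ⟨j + 1, by omega, by omega, fun n => Nat.casesOn n q₀ q, ?_, rfl, ?_, ?_⟩
  · rintro (_ | n) hn
    · exact h₀
    · exact hQ n (by omega)
  · obtain ⟨k, rfl⟩ : ∃ k, j = k + 1 := ⟨j - 1, by omega⟩
    exact hend
  · rintro (_ | n) hn
    · exact hstart ▸ hs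
    · exact hstep n (by omega)

theorem Leads.consA {W : Type*} {Q : Set (W × W × W × W)} {p : ℕ} {x y z w : W}
    {t' : W × W × W} (h₀ : (x, y, z, w) ∈ Q) (h : Leads Q p (y, w, z) t') :
    Leads Q (p + 1) (x, y, z) t' :=
  Leads.cons h₀ (Or.inl rfl) h

theorem Leads.consB {W : Type*} {Q : Set (W × W × W × W)} {p : ℕ} {x y z w : W}
    {t' : W × W × W} (h₀ : (x, y, z, w) ∈ Q) (h : Leads Q p (z, y, w) t') :
    Leads Q (p + 1) (x, y, z) t' :=
  Leads.cons h₀ (Or.inr rfl) h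

/-- A point of `D x y z` can be found satisfying any property that holds near `x`. -/
theorem exists_O4_of_eventually {W : Type*} [TopologicalSpace W] {D : W → W → W → Set W}
    (h3 : ∀ a b c : W, (a, b, c) ∈ O3 W → a ∈ closure (D a b c))
    {x y z : W} (hxy : x ≠ y) (hxz : x ≠ z) (hyz : y ≠ z) {P : W → Prop}
    (hP : ∀ᶠ w in 𝓝 x, P w) : ∃ w, (x, y, z, w) ∈ O4 D ∧ P w := by
  have hO : (x, y, z) ∈ O3 W := ⟨hxy, hxz, hyz⟩
  obtain ⟨w, hw, hPw⟩ := ((mem_closure_iff_frequently.1 (h3 x y z hO)).and_eventually hP).exists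
  exact ⟨w, ⟨hO, hw⟩, hPw⟩

/-- Step 3: every `(a₁,b₁,c₁) ∈ O₃` close enough to `(a,b,c)` satisfies
`(a,b,c) ⇝³⁶ (a₁,b₁,c₁)`; in particular `(a,b,c) ⇝³⁶ (a,b,c)`. -/
theorem leads_step3 {W : Type*} [MetricSpace W] (D : W → W → W → Set W)
    (h2 : ∀ a b c : W, (a, b, c) ∈ O3 W → Dense (D a b c ∪ D a c b))
    (h3 : ∀ a b c : W, (a, b, c) ∈ O3 W → a ∈ closure (D a b c))
    (h4open : IsOpen (O4 D))
    (h4dist : ∀ a b c d : W, (a, b, c, d) ∈ O4 D →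
      a ≠ b ∧ a ≠ c ∧ a ≠ d ∧ b ≠ c ∧ b ≠ d ∧ c ≠ d)
    (h4rev : ∀ a b c d : W, (a, b, c, d) ∈ O4 D → (d, c, b, a) ∈ O4 D)
    (a b c : W) (habc : (a, b, c) ∈ O3 W) :
    (∃ V ∈ 𝓝 ((a, b, c) : W × W × W), ∀ a₁ b₁ c₁ : W,
        (a₁, b₁, c₁) ∈ O3 W → (a₁, b₁, c₁) ∈ V →
        Leads (O4 D) 36 (a, b, c) (a₁, b₁, c₁)) ∧
      Leads (O4 D) 36 (a, b, c) (a, b, c) := by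
  have near : ∀ {X : Type _} [TopologicalSpace X] (f : X → W × W × W × W) (p : X),
      f p ∈ O4 D → Continuous f → ∀ᶠ r in 𝓝 p, f r ∈ O4 D := fun f p hp hf =>
    hf.continuousAt.eventually_mem (h4open.mem_nhds hp)
  obtain ⟨hab, hac, hbc⟩ : a ≠ b ∧ a ≠ c ∧ b ≠ c := habc
  obtain ⟨x, hx, -⟩ := exists_O4_of_eventually h3 hac.symm hbc.symm hab
    (Filter.Eventually.of_forall fun _ => trivial)
  obtain ⟨-, -, -, -, hax, hbx⟩ := h4dist _ _ _ _ hx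
  obtain ⟨y, hy, -⟩ := exists_O4_of_eventually h3 hax hab hbx.symm
    (Filter.Eventually.of_forall fun _ => trivial)
  obtain ⟨-, -, -, -, hxy, hby⟩ := h4dist _ _ _ _ hy
  obtain ⟨z, hz, -⟩ := exists_O4_of_eventually h3 hbx hby hxy
    (Filter.Eventually.of_forall fun _ => trivial)
  obtain ⟨-, -, -, -, hxz, hyz⟩ := h4dist _ _ _ _ hz
  obtain ⟨r, hr, hr₁, hr₂⟩ := exists_O4_of_eventually h3 hab hac hbc
    ((near (fun r => (c, r, b, x)) a hx (by fun_prop)).and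
      (near (fun r => (r, x, b, y)) a hy (by fun_prop)))
  obtain ⟨-, -, -, -, hbr, hcr⟩ := h4dist _ _ _ _ hr
  obtain ⟨s, hs, hs₁, hs₂, hs₃⟩ := exists_O4_of_eventually h3 hbr hbc hcr.symm
    ((near (fun s => (c, r, s, x)) b hr₁ (by fun_prop)).and
      ((near (fun s => (r, x, s, y)) b hr₂ (by fun_prop)).and
        (near (fun s => (s, x, y, z)) b hz (by fun_prop))))
  obtain ⟨u, hu, hu₁, hu₂⟩ := exists_O4_of_eventually h3 hxy.symm hyz hxz
    ((near (fun u => (z, u, x, b)) y (h4rev _ _ _ _ hz) (by fun_prop)).and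
      (near (fun u => (u, b, x, a)) y (h4rev _ _ _ _ hy) (by fun_prop)))
  obtain ⟨-, -, -, -, hxu, hzu⟩ := h4dist _ _ _ _ hu
  obtain ⟨v, hv, hv₁, hv₂, hv₃⟩ := exists_O4_of_eventually h3 hxu hxz hzu.symm
    ((near (fun v => (z, u, v, b)) x hu₁ (by fun_prop)).and
      ((near (fun v => (u, b, v, a)) x hu₂ (by fun_prop)).and
        (near (fun v => (v, b, a, c)) x (h4rev _ _ _ _ hx) (by fun_prop))))
  have hV : ∀ᶠ t : W × W × W in 𝓝 (a, b, c), Leads (O4 D) 36 (a, b, c) t := by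
    filter_upwards [near (fun t : W × W × W => (z, u, v, t.2.1)) (a, b, c) hv₁ (by fun_prop),
      near (fun t : W × W × W => (u, t.2.1, v, t.1)) (a, b, c) hv₂ (by fun_prop),
      near (fun t : W × W × W => (v, t.2.1, t.1, t.2.2)) (a, b, c) hv₃ (by fun_prop)]
      with t ht₁ ht₂ ht₃
    have chain := Leads.consA hr <| .consB hs <| .consA hs₁ <| .consB hs₂ <| .consB hs₃ <|
      .consA hu <| .consB hv <| .consA ht₁ <| .consB ht₂ <| .single ht₃
    exact chain.mono (by norm_num)
  exact ⟨⟨_, hV, fun _ _ _ _ h => h⟩, hV.self_of_nhds⟩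
end

section
/- (The cross-ratio configuration data is Markov.) For all triples t = (a,b,c) and t' = (d,e,f) of pairwise distinct complex numbers, one has t ⇝¹⁰⁰⁰ t', where the relation ⇝ᵖ is defined by chains of quadruples of pairwise distinct complex numbers whose cross-ratio has nonzero imaginary part. -/
open Topology

/-- The set of quadruples of pairwise distinct complex numbers whose cross-ratio has
nonzero imaginary part. -/
def O4crossRatio : Set (ℂ × ℂ × ℂ × ℂ) :=
  {q | q.1 ≠ q.2.1 ∧ q.1 ≠ q.2.2.1 ∧ q.1 ≠ q.2.2.2 ∧ q.2.1 ≠ q.2.2.1 ∧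
      q.2.1 ≠ q.2.2.2 ∧ q.2.2.1 ≠ q.2.2.2 ∧
      (crossRatio q.1 q.2.1 q.2.2.1 q.2.2.2).im ≠ 0}

/-- The numerator of the imaginary part of the cross-ratio. It vanishes exactly when the four
points lie on a common circle or line. -/
noncomputable def crossIm (a b c d : ℂ) : ℝ :=
  ((d - a) * (b - c) * (starRingEnd ℂ) ((d - c) * (b - a))).im

theorem mem_O4crossRatio_of_crossIm_ne_zero {a b c d : ℂ} (h : crossIm a b c d ≠ 0) :
    (a, b, c, d) ∈ O4crossRatio := by
  refine ⟨?_, ?_, ?_, ?_, ?_, ?_, fun h0 => h ?_⟩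
  iterate 6
    · rintro heq
      simp only at heq
      subst heq
      apply h
      simp [crossIm]
      try ring
  have hdiv : crossIm a b c d = (crossRatio a b c d).im * Complex.normSq ((d - c) * (b - a)) := by
    rw [crossIm, crossRatio, Complex.div_im]
    by_cases hn : Complex.normSq ((d - c) * (b - a)) = 0
    · rw [Complex.normSq_eq_zero] at hn
      simp [hn]
    · rw [sub_mul (_ / _), div_mul_cancel₀ _ hn, div_mul_cancel₀ _ hn, Complex.mul_im,
        Complex.conj_re, Complex.conj_im]
      ring
  rw [hdiv, show (crossRatio a b c d).im = 0 from h0, zero_mul]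

theorem crossIm_rotate_last (a b c d : ℂ) : crossIm a d b c = crossIm a b c d := by
  simp [crossIm]
  ring

theorem crossIm_rotate_outer (a b c d : ℂ) : crossIm d b a c = crossIm a b c d := by
  simp [crossIm]
  ring

/-- All but finitely many points of the parabola `s + s² i` avoid the circle or line through
three given distinct points. -/
theorem eventually_crossIm_ne_zero {a b c : ℂ} (hab : a ≠ b) (hac : a ≠ c) (hbc : b ≠ c) :
    ∀ᶠ s : ℝ in Filter.cofinite, crossIm a b c ⟨s, s ^ 2⟩ ≠ 0 := by
  set α : ℝ := ((b - c) * (starRingEnd ℂ) (b - a)).im with hα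
  set w : ℂ := (b - c) * (starRingEnd ℂ) ((a - c) * (b - a)) with hw
  have hw0 : w ≠ 0 :=
    mul_ne_zero (sub_ne_zero.2 hbc) ((map_ne_zero _).2
      (mul_ne_zero (sub_ne_zero.2 hac) (sub_ne_zero.2 hab.symm)))
  have hform (s : ℝ) : crossIm a b c ⟨s, s ^ 2⟩ =
      α * ((s - a.re) ^ 2 + (s ^ 2 - a.im) ^ 2) + w.im * (s - a.re) + w.re * (s ^ 2 - a.im) := by
    simp [crossIm, hα, hw]
    ring
  let P : Polynomial ℝ := .C α * ((.X - .C a.re) ^ 2 + (.X ^ 2 - .C a.im) ^ 2) +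
    .C w.im * (.X - .C a.re) + .C w.re * (.X ^ 2 - .C a.im)
  have heval (s : ℝ) : P.eval s = crossIm a b c ⟨s, s ^ 2⟩ := by
    simp [P, hform]
  have hP : P ≠ 0 := by
    intro hP
    have hz (s : ℝ) : α * ((s - a.re) ^ 2 + (s ^ 2 - a.im) ^ 2) + w.im * (s - a.re) +
        w.re * (s ^ 2 - a.im) = 0 := by
      rw [← hform, ← heval, hP, Polynomial.eval_zero]
    have hα0 : α = 0 := by linarith [hz 0, hz 1, hz (-1), hz 2, hz (-2)]
    simp only [hα0, zero_mul, zero_add] at hz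
    exact hw0 (Complex.ext
      (by rw [Complex.zero_re]; linarith [hz 0, hz 1, hz (-1)])
      (by rw [Complex.zero_im]; linarith [hz 1, hz (-1)]))
  refine Filter.eventually_cofinite.2 ((Polynomial.finite_setOfPred_isRoot hP).subset ?_)
  intro s hs
  simpa [Polynomial.IsRoot, heval] using hs

theorem eventually_parabola_ne (x : ℂ) : ∀ᶠ s : ℝ in Filter.cofinite, (⟨s, s ^ 2⟩ : ℂ) ≠ x := by
  refine Filter.eventually_cofinite.2 ((Set.finite_singleton x.re).subset ?_)
  intro s hs
  simp only [ne_eq, not_not, Set.mem_ofPred_eq] at hs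
  simp [← hs]

/-- The cross-ratio configuration data on `ℂ` is Markov with constant `1000`: any two
triples of pairwise distinct complex numbers satisfy `t ⇝¹⁰⁰⁰ t'`. -/
theorem crossRatio_leads_markov (t t' : ℂ × ℂ × ℂ) (ht : t ∈ O3 ℂ) (ht' : t' ∈ O3 ℂ) :
    Leads O4crossRatio 1000 t t' := by
  obtain ⟨a, b, c⟩ := t
  obtain ⟨x, y, z⟩ := t'
  obtain ⟨hab, hac, hbc⟩ := ht
  obtain ⟨hxy, hxz, hyz⟩ := ht'
  obtain ⟨s, hs, hsx, hsy⟩ := ((eventually_crossIm_ne_zero hab hac hbc).and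
    ((eventually_parabola_ne x).and (eventually_parabola_ne y))).exists
  generalize (⟨s, s ^ 2⟩ : ℂ) = p at hs hsx hsy
  obtain ⟨-, -, -, -, hbp, hcp, -⟩ := mem_O4crossRatio_of_crossIm_ne_zero hs
  obtain ⟨s, hq, hqx⟩ := ((eventually_crossIm_ne_zero hbc.symm hcp hbp).and
    (eventually_parabola_ne x)).exists
  generalize (⟨s, s ^ 2⟩ : ℂ) = q at hq hqx
  obtain ⟨-, -, -, -, hbq, hpq, -⟩ := mem_O4crossRatio_of_crossIm_ne_zero hq
  obtain ⟨s, hr, hrx, hry, hrz⟩ := ((eventually_crossIm_ne_zero hbq hbp hpq.symm).and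
    ((eventually_crossIm_ne_zero hpq.symm hqx hsx).and
    ((eventually_crossIm_ne_zero hsx hsy hxy).and
    (eventually_crossIm_ne_zero hxy hxz hyz)))).exists
  generalize (⟨s, s ^ 2⟩ : ℂ) = r at hr hrx hry hrz
  rw [← crossIm_rotate_last] at hrx hry
  rw [← crossIm_rotate_outer] at hrz
  refine ⟨6, by norm_num, by norm_num, fun n => match n with
    | 0 => (a, b, c, p)
    | 1 => (c, b, p, q)
    | 2 => (b, q, p, r)
    | 3 => (q, r, p, x)
    | 4 => (p, r, x, y)
    | _ => (r, y, x, z), ?_, rfl, rfl, ?_⟩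
  · intro n hn
    interval_cases n <;> exact mem_O4crossRatio_of_crossIm_ne_zero ‹_›
  · intro n hn
    replace hn : n < 5 := by omega
    interval_cases n
    · exact Or.inr rfl
    · exact Or.inl rfl
    · exact Or.inl rfl
    · exact Or.inr rfl
    · exact Or.inl rfl
end

section
/- (Basepoint independence of the measure built from an equivariant family of measures.) Let ∂ be a measurable space and M a nonempty set. Let x ↦ μ_x be a family of σ-finite measures on ∂ indexed by M, let c : ∂ × M × M → ℝ be such that a ↦ c(a, x, y) is measurable for all x, y ∈ M, and let β : ∂ × ∂ × ∂ → M be a map such that for each x ∈ M the function (a, b, e) ↦ c(a, x, β(a,b,e)) + c(b, x, β(a,b,e)) + c(e, x, β(a,b,e)) is measurable. Assume the cocycle identity c(a, x, z) = c(a, x, y) + c(a, y, z) for all a ∈ ∂ and x, y, z ∈ M, and assume that for all x, y ∈ M one has μ_x = (μ_y).withDensity(a ↦ exp(−c(a, x, y))). Then the measure μ̄³_x := (μ_x ⊗ μ_x ⊗ μ_x).withDensity((a,b,e) ↦ exp(c(a, x, β(a,b,e)) + c(b, x, β(a,b,e)) + c(e, x, β(a,b,e)))) on ∂ × ∂ ×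 ∂ does not depend on x: μ̄³_x = μ̄³_y for all x, y ∈ M. -/
open MeasureTheory

/-- Basepoint independence: the measure `μ̄³` built from an equivariant family of
measures `x ↦ μ_x`, a cocycle `c` and a barycenter map `β` does not depend on the
basepoint `x`. -/
theorem barycentric_measure_basepoint_independent {B M : Type*}
    [MeasurableSpace B] [Nonempty M]
    (μ : M → Measure B) (hσ : ∀ x : M, SigmaFinite (μ x))
    (c : B → M → M → ℝ) (β : B → B → B → M)
    (hc_meas : ∀ x y : M, Measurable fun a : B => c a x y)
    (hρ_meas : ∀ x : M, Measurable fun p : B × B × B =>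
      c p.1 x (β p.1 p.2.1 p.2.2) + c p.2.1 x (β p.1 p.2.1 p.2.2)
        + c p.2.2 x (β p.1 p.2.1 p.2.2))
    (hcocycle : ∀ (a : B) (x y z : M), c a x z = c a x y + c a y z)
    (hdens : ∀ x y : M,
      μ x = (μ y).withDensity fun a => ENNReal.ofReal (Real.exp (-(c a x y))))
    (x y : M) :
    (((μ x).prod ((μ x).prod (μ x))).withDensity fun p : B × B × B =>
        ENNReal.ofReal (Real.exp (c p.1 x (β p.1 p.2.1 p.2.2)
          + c p.2.1 x (β p.1 p.2.1 p.2.2) + c p.2.2 x (β p.1 p.2.1 p.2.2))))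
    = (((μ y).prod ((μ y).prod (μ y))).withDensity fun p : B × B × B =>
        ENNReal.ofReal (Real.exp (c p.1 y (β p.1 p.2.1 p.2.2)
          + c p.2.1 y (β p.1 p.2.1 p.2.2) + c p.2.2 y (β p.1 p.2.1 p.2.2)))) := by
  have hf : Measurable fun a : B => ENNReal.ofReal (Real.exp (-(c a x y))) :=
    (hc_meas x y).neg.exp.ennreal_ofReal
  have hf₂ : Measurable fun p : B × B =>
      ENNReal.ofReal (Real.exp (-(c p.1 x y))) * ENNReal.ofReal (Real.exp (-(c p.2 x y))) :=
    (hf.comp measurable_fst).mul (hf.comp measurable_snd)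
  have hf₃ : Measurable fun p : B × B × B => ENNReal.ofReal (Real.exp (-(c p.1 x y))) *
      (ENNReal.ofReal (Real.exp (-(c p.2.1 x y))) * ENNReal.ofReal (Real.exp (-(c p.2.2 x y)))) :=
    (hf.comp measurable_fst).mul (hf₂.comp measurable_snd)
  have := hσ y
  rw [hdens x y, prod_withDensity hf hf, prod_withDensity hf hf₂,
    ← withDensity_mul _ hf₃ (hρ_meas x).exp.ennreal_ofReal]
  congr 1
  funext p
  simp only [Pi.mul_apply]
  rw [← ENNReal.ofReal_mul (Real.exp_nonneg _), ← Real.exp_add,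
    ← ENNReal.ofReal_mul (Real.exp_nonneg _), ← Real.exp_add,
    ← ENNReal.ofReal_mul (Real.exp_nonneg _), ← Real.exp_add]
  congr 2
  linarith [hcocycle p.1 x y (β p.1 p.2.1 p.2.2), hcocycle p.2.1 x y (β p.1 p.2.1 p.2.2),
    hcocycle p.2.2 x y (β p.1 p.2.1 p.2.2)]
end

section
/- (Measure class of a kernel composition.) Let Z and W be measurable spaces, ρ a σ-finite measure on Z, m a σ-finite measure on W, O ⊆ Z × W a measurable set, κ an s-finite kernel from Z to W, and μ a σ-finite measure on Z. Assume that μ and ρ are mutually absolutely continuous, and that for μ-almost every z ∈ Z the measures κ(z) and m restricted to the slice {w ∈ W : (z, w) ∈ O} are mutually absolutely continuous. Then the composition μ ⊗ₖ κ (the measure on Z × W determined by (μ ⊗ₖ κ)(S) = ∫ κ(z)({w : (z,w) ∈ S}) dμ(z)) and the restriction of the product measure ρ ⊗ m to O are mutually absolutely continuous. -/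
open MeasureTheory ProbabilityTheory

/-- A measurable set is null for the restriction of a product measure to `O` iff almost all of
its slices are null for the restriction of the second factor to the slices of `O`. -/
lemma prod_restrict_null_iff {Z W : Type*} [MeasurableSpace Z] [MeasurableSpace W]
    (ρ : Measure Z) (m : Measure W) [SFinite m] {O S : Set (Z × W)}
    (hO : MeasurableSet O) (hS : MeasurableSet S) :
    (ρ.prod m).restrict O S = 0 ↔
      ∀ᵐ z ∂ρ, m.restrict {w : W | (z, w) ∈ O} (Prod.mk z ⁻¹' S) = 0 := by
  rw [Measure.restrict_apply hS, Measure.measure_prod_null (hS.inter hO)]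
  refine Filter.eventually_congr (.of_forall fun z => ?_)
  rw [Measure.restrict_apply (measurable_prodMk_left hS)]
  rfl

/-- A measurable set is null for `μ ⊗ₘ κ` iff almost all of its slices are null for `κ`. -/
lemma measure_compProd_null_iff {Z W : Type*} [MeasurableSpace Z] [MeasurableSpace W]
    (μ : Measure Z) [SFinite μ] (κ : Kernel Z W) [IsSFiniteKernel κ] {S : Set (Z × W)}
    (hS : MeasurableSet S) :
    μ.compProd κ S = 0 ↔ ∀ᵐ z ∂μ, κ z (Prod.mk z ⁻¹' S) = 0 := by
  rw [Measure.compProd_apply hS,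
    lintegral_eq_zero_iff (Kernel.measurable_kernel_prodMk_left hS)]
  rfl

/-- Measure class of a kernel composition: if `μ` is in the measure class of `ρ` and
`κ z` is in the measure class of `m` restricted to the slice `O_z` for `μ`-almost every
`z`, then `μ ⊗ₖ κ` is in the measure class of `(ρ ⊗ m)` restricted to `O`. -/
theorem compProd_measure_class {Z W : Type*} [MeasurableSpace Z] [MeasurableSpace W]
    (ρ : Measure Z) [SigmaFinite ρ] (m : Measure W) [SigmaFinite m]
    (O : Set (Z × W)) (hO : MeasurableSet O)
    (κ : Kernel Z W) [IsSFiniteKernel κ]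
    (μ : Measure Z) [SigmaFinite μ]
    (hμρ : μ ≪ ρ) (hρμ : ρ ≪ μ)
    (hκ : ∀ᵐ z ∂μ, κ z ≪ m.restrict {w : W | (z, w) ∈ O} ∧
      m.restrict {w : W | (z, w) ∈ O} ≪ κ z) :
    μ.compProd κ ≪ (ρ.prod m).restrict O ∧ (ρ.prod m).restrict O ≪ μ.compProd κ := by
  refine ⟨.mk fun S hS h => ?_, .mk fun S hS h => ?_⟩
  · rw [prod_restrict_null_iff ρ m hO hS] at h
    rw [measure_compProd_null_iff μ κ hS]
    filter_upwards [hκ, hμρ.ae_le h] with z hz h0 using hz.1 h0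
  · rw [measure_compProd_null_iff μ κ hS] at h
    rw [prod_restrict_null_iff ρ m hO hS]
    filter_upwards [hρμ.ae_le hκ, hρμ.ae_le h] with z hz h0 using hz.2 h0
end

section
/- (Measure class of the disintegration.) Let X and Y be standard Borel spaces, μ a finite measure on X × Y, ν a σ-finite measure on X, m a σ-finite measure on Y, and O ⊆ X × Y a measurable set. Assume that μ and the restriction of ν ⊗ m to O are mutually absolutely continuous. Then, denoting by μ_X the first marginal of μ and by x ↦ μ|_x the disintegration (conditional kernel) of μ over μ_X, for μ_X-almost every x ∈ X the conditional measure μ|_x and the measure m restricted to the slice O_x = {y ∈ Y : (x, y) ∈ O} are mutually absolutely continuous. -/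
open MeasureTheory

/-- The kernel sending `x` to the restriction of `m` to the slice of `O` over `x`. -/
noncomputable def sliceKernel {X Y : Type*} [MeasurableSpace X] [MeasurableSpace Y]
    (m : Measure Y) [IsFiniteMeasure m] (O : Set (X × Y)) : ProbabilityTheory.Kernel X Y :=
  ProbabilityTheory.Kernel.withDensity (ProbabilityTheory.Kernel.const X m)
    fun x y => O.indicator 1 (x, y)

section sliceKernel

open ProbabilityTheory

variable {X Y : Type*} [MeasurableSpace X] [MeasurableSpace Y]

lemma sliceKernel_apply (m : Measure Y) [IsFiniteMeasure m] {O : Set (X × Y)}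
    (hO : MeasurableSet O) (x : X) :
    sliceKernel m O x = m.restrict {y : Y | (x, y) ∈ O} := by
  have hmeas : Measurable (Function.uncurry fun (x : X) (y : Y) => O.indicator 1 (x, y) :
      X × Y → ENNReal) := measurable_one.indicator hO
  rw [sliceKernel, Kernel.withDensity_apply _ hmeas, Kernel.const_apply]
  exact withDensity_indicator_one (measurable_prodMk_left hO)

lemma isFiniteKernel_sliceKernel (m : Measure Y) [IsFiniteMeasure m] {O : Set (X × Y)}
    (hO : MeasurableSet O) : IsFiniteKernel (sliceKernel m O) := by
  refine ⟨m Set.univ, measure_lt_top m _, fun x => ?_⟩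
  rw [sliceKernel_apply m hO]
  exact Measure.restrict_apply_le _ _

lemma compProd_sliceKernel (ν : Measure X) [SFinite ν] (m : Measure Y) [IsFiniteMeasure m]
    {O : Set (X × Y)} (hO : MeasurableSet O) :
    ν.compProd (sliceKernel m O) = (ν.prod m).restrict O := by
  have := isFiniteKernel_sliceKernel m hO
  ext s hs
  rw [Measure.compProd_apply hs, Measure.restrict_apply hs, Measure.prod_apply (hs.inter hO)]
  refine lintegral_congr fun x => ?_
  rw [sliceKernel_apply m hO, Measure.restrict_apply (measurable_prodMk_left hs)]
  rfl

end sliceKernel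

/-- Measure class of the disintegration: if a finite measure `μ` on `X × Y` is in the
measure class of `(ν ⊗ m)` restricted to `O`, then for almost every `x` (with respect
to the first marginal of `μ`) the conditional measure `μ|_x` is in the measure class of
`m` restricted to the slice `O_x`. -/
theorem condKernel_measure_class {X Y : Type*}
    [MeasurableSpace X] [StandardBorelSpace X]
    [MeasurableSpace Y] [StandardBorelSpace Y] [Nonempty Y]
    (μ : Measure (X × Y)) [IsFiniteMeasure μ]
    (ν : Measure X) [SigmaFinite ν] (m : Measure Y) [SigmaFinite m]
    (O : Set (X × Y)) (hO : MeasurableSet O)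
    (hac : μ ≪ (ν.prod m).restrict O) (hac' : (ν.prod m).restrict O ≪ μ) :
    ∀ᵐ x ∂μ.fst, μ.condKernel x ≪ m.restrict {y : Y | (x, y) ∈ O} ∧
      m.restrict {y : Y | (x, y) ∈ O} ≪ μ.condKernel x := by
  have := isFiniteKernel_sliceKernel m.toFinite hO
  have hm : m ≪ m.toFinite := absolutelyContinuous_toFinite m
  have hm' : m.toFinite ≪ m := toFinite_absolutelyContinuous m
  have hμκ : μ ≪ ν.compProd (sliceKernel m.toFinite O) := by
    rw [compProd_sliceKernel ν _ hO]
    exact hac.trans ((Measure.AbsolutelyContinuous.rfl.prod hm).restrict O)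
  have hκμ : ν.compProd (sliceKernel m.toFinite O) ≪ μ := by
    rw [compProd_sliceKernel ν _ hO]
    exact ((Measure.AbsolutelyContinuous.rfl.prod hm').restrict O).trans hac'
  have hfst : μ.fst ≪ ν :=
    (hac.map measurable_fst).trans
      ((Measure.absolutelyContinuous_of_le Measure.restrict_le_self).map measurable_fst
        |>.trans Measure.quasiMeasurePreserving_fst.absolutelyContinuous)
  have h₁ : μ.fst.compProd μ.condKernel ≪ ν.compProd (sliceKernel m.toFinite O) := by
    rwa [μ.disintegrate μ.condKernel]
  have h₂ : μ.fst.compProd (sliceKernel m.toFinite O) ≪ μ.fst.compProd μ.condKernel := by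
    rw [μ.disintegrate μ.condKernel]
    exact (hfst.compProd_left _).trans hκμ
  filter_upwards [h₁.kernel_of_compProd, h₂.kernel_of_compProd] with x hx₁ hx₂
  rw [sliceKernel_apply _ hO] at hx₁ hx₂
  exact ⟨hx₁.trans (hm'.restrict _), (hm.restrict _).trans hx₂⟩
end

section
/- (Hopf argument for pseudo-Markov systems.) Let X be a Polish metric space, γ : X → X a homeomorphism, and μ a finite Borel measure on X invariant under γ. Let R⁺ and R⁻ be binary relations on X such that: (1) whenever R⁺(f, g) holds, d(γⁿ(f), γⁿ(g)) → 0 as n → +∞; (2) whenever R⁻(f, g) holds, d(γ⁻ⁿ(f), γ⁻ⁿ(g)) → 0 as n → +∞; and (3) for every Borel set E ⊆ X with μ(X ∖ E) = 0, for μ-almost every f ∈ X, for μ-almost every g ∈ X, there exists h ∈ E with R⁺(f, h) and R⁻(h, g). Then γ is ergodic with respect to μ: every Borel set S with γ⁻¹(S) = S satisfies μ(S) = 0 or μ(X ∖ S) = 0. -/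
open MeasureTheory Filter Topology Set

/-- The limit in measure of functions that are asymptotically constant along the relation
`R` agrees almost everywhere with a function that is constant along `R`. -/
theorem exists_invariant_ae_eq_of_tendstoInMeasure {X : Type*} [MeasurableSpace X]
    {μ : Measure X} {R : X → X → Prop} {u : ℕ → X → ℝ} {φ : X → ℝ}
    (hu : TendstoInMeasure μ u atTop φ)
    (hR : ∀ x y, R x y → Tendsto (fun n => u n x - u n y) atTop (𝓝 0)) :
    ∃ F : X → ℝ, (∀ x y, R x y → F x = F y) ∧ F =ᵐ[μ] φ := by
  obtain ⟨ns, hns, hlim⟩ := hu.exists_seq_tendsto_ae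
  refine ⟨fun x => limUnder atTop fun i => u (ns i) x, fun x y hxy => ?_, ?_⟩
  · have h := (hR x y hxy).comp hns.tendsto_atTop
    simp only [limUnder, lim]
    congr 1
    ext c
    refine ⟨fun hc => ?_, fun hc => ?_⟩
    · have := Tendsto.sub (show Tendsto (fun i => u (ns i) x) atTop (𝓝 c) from hc) h
      simpa [Tendsto] using this
    · have := Tendsto.add (show Tendsto (fun i => u (ns i) y) atTop (𝓝 c) from hc) h
      simpa [Tendsto] using this
  · filter_upwards [hlim] with x hx using hx.limUnder_eq

/-- Birkhoff averages of a uniformly continuous function along two forward asymptotic orbits are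
asymptotic to each other. -/
theorem tendsto_birkhoffAverage_sub_of_tendsto_dist {X : Type*} [PseudoMetricSpace X]
    {T : X → X} {g : X → ℝ} (hg : UniformContinuous g) {x y : X}
    (hxy : Tendsto (fun n : ℕ => dist (T^[n] x) (T^[n] y)) atTop (𝓝 0)) :
    Tendsto (fun n => birkhoffAverage ℝ T g n x - birkhoffAverage ℝ T g n y) atTop (𝓝 0) := by
  have h : Tendsto (fun n : ℕ => g (T^[n] x) - g (T^[n] y)) atTop (𝓝 0) := by
    rw [tendsto_zero_iff_norm_tendsto_zero]
    simp only [← dist_eq_norm]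
    have hunif := Metric.uniformContinuous_iff.1 hg
    rw [Metric.tendsto_atTop] at hxy ⊢
    intro ε hε
    obtain ⟨δ, hδ, H⟩ := hunif ε hε
    obtain ⟨N, hN⟩ := hxy δ hδ
    refine ⟨N, fun n hn => ?_⟩
    simpa using H (by simpa using hN n hn)
  simpa [birkhoffAverage, birkhoffSum, Finset.sum_sub_distrib, mul_sub] using h.cesaro

section Koopman

variable {X : Type*} [MeasurableSpace X] {μ : Measure X}

theorem iterate_compMeasurePreserving_toLp {T : X → X} (hT : MeasurePreserving T μ μ) {g : X → ℝ}
    (hg : MemLp g 2 μ) (n : ℕ) :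
    (⇑(Lp.compMeasurePreservingₗᵢ ℝ T hT : Lp ℝ 2 μ →ₗᵢ[ℝ] Lp ℝ 2 μ).toContinuousLinearMap)^[n]
        (hg.toLp g) =
      (hg.comp_measurePreserving (hT.iterate n)).toLp (g ∘ T^[n]) := by
  induction n with
  | zero => rfl
  | succ n ih =>
    rw [Function.iterate_succ_apply', ih]
    rfl

theorem birkhoffAverage_compMeasurePreserving_toLp_ae_eq {T : X → X}
    (hT : MeasurePreserving T μ μ) {g : X → ℝ} (hg : MemLp g 2 μ) (N : ℕ) :
    (birkhoffAverage ℝ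
        (Lp.compMeasurePreservingₗᵢ ℝ T hT : Lp ℝ 2 μ →ₗᵢ[ℝ] Lp ℝ 2 μ).toContinuousLinearMap
        id N (hg.toLp g) : Lp ℝ 2 μ) =ᵐ[μ] birkhoffAverage ℝ T g N := by
  simp only [birkhoffAverage, birkhoffSum, id_eq, iterate_compMeasurePreserving_toLp hT hg]
  have hsum : ∀ s : Finset ℕ,
      (∑ n ∈ s, (hg.comp_measurePreserving (hT.iterate n)).toLp (g ∘ T^[n]) : Lp ℝ 2 μ)
        =ᵐ[μ] fun x => ∑ n ∈ s, g (T^[n] x) := by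
    intro s
    induction s using Finset.induction_on with
    | empty =>
      simp only [Finset.sum_empty]
      exact Lp.coeFn_zero ℝ 2 μ
    | insert n s hn ih =>
      simp only [Finset.sum_insert hn]
      filter_upwards [Lp.coeFn_add ((hg.comp_measurePreserving (hT.iterate n)).toLp (g ∘ T^[n]))
        (∑ n ∈ s, (hg.comp_measurePreserving (hT.iterate n)).toLp (g ∘ T^[n])), ih,
        (hg.comp_measurePreserving (hT.iterate n)).coeFn_toLp] with x h1 h2 h3
      rw [h1, Pi.add_apply, h2, h3, Function.comp_apply]
  filter_upwards [Lp.coeFn_smul ((N : ℝ)⁻¹)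
    (∑ n ∈ Finset.range N, (hg.comp_measurePreserving (hT.iterate n)).toLp (g ∘ T^[n])),
    hsum (Finset.range N)] with x h1 h2
  rw [h1, Pi.smul_apply, h2]
  rfl

end Koopman

section Density

variable {X : Type*} [PseudoMetricSpace X] [MeasurableSpace X] [BorelSpace X]
  {μ : Measure X} [IsFiniteMeasure μ]

/-- A closed set of `L²` functions containing all bounded uniformly continuous functions contains
the indicators of closed sets. -/
theorem indicatorConstLp_mem_of_isClosed {D : Set (Lp ℝ 2 μ)} (hD : IsClosed D)
    (hunif : ∀ (g : X → ℝ) (hg : MemLp g 2 μ), UniformContinuous g → hg.toLp g ∈ D)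
    {K : Set X} (hK : IsClosed K) :
    indicatorConstLp 2 hK.measurableSet (measure_ne_top μ K) (1 : ℝ) ∈ D := by
  let δ : ℕ → ℝ := fun n => 1 / ((n : ℝ) + 1)
  have δpos : ∀ n, 0 < δ n := fun n => Nat.one_div_pos_of_nat
  have δlim : Tendsto δ atTop (𝓝[>] 0) :=
    tendsto_nhdsWithin_iff.2 ⟨tendsto_one_div_add_atTop_nhds_zero_nat, .of_forall δpos⟩
  let g : ℕ → X → ℝ := fun n x => (thickenedIndicator (δpos n) K x : ℝ)
  have gunif : ∀ n, UniformContinuous (g n) := fun n =>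
    uniformContinuous_subtype_val.comp
      (lipschitzWith_thickenedIndicator (δpos n) K).uniformContinuous
  have gle : ∀ n x, g n x ≤ 1 := fun n x => mod_cast thickenedIndicator_le_one (δpos n) K x
  have gnonneg : ∀ n x, 0 ≤ g n x := fun n x => NNReal.coe_nonneg _
  have gmem : ∀ n, MemLp (g n) 2 μ := fun n =>
    MemLp.of_bound (gunif n).continuous.aestronglyMeasurable 1 <| .of_forall fun x => by
      rw [Real.norm_of_nonneg (gnonneg n x)]
      exact gle n x
  have hth : ∀ n, MeasurableSet (Metric.thickening (δ n) K) := fun n =>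
    Metric.isOpen_thickening.measurableSet
  have hsub : ∀ n, K ⊆ Metric.thickening (δ n) K := fun n =>
    Metric.self_subset_thickening (δpos n) K
  have hlim : Tendsto
      (fun n => indicatorConstLp 2 (hth n) (measure_ne_top μ (Metric.thickening (δ n) K)) (1 : ℝ))
      atTop (𝓝 (indicatorConstLp 2 hK.measurableSet (measure_ne_top μ K) (1 : ℝ))) := by
    refine tendsto_indicatorConstLp_set (by simp) ?_
    have h1 : Tendsto (fun n => μ (Metric.thickening (δ n) K)) atTop (𝓝 (μ K)) :=
      (tendsto_measure_thickening_of_isClosed ⟨1, one_pos, measure_ne_top μ _⟩ hK).comp δlim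
    have h2 := ENNReal.Tendsto.sub h1 (tendsto_const_nhds (x := μ K)) (.inl (measure_ne_top μ K))
    rw [tsub_self] at h2
    refine h2.congr fun n => ?_
    rw [symmDiff_of_ge (hsub n),
      measure_sdiff (hsub n) hK.measurableSet.nullMeasurableSet (measure_ne_top μ K)]
  refine hD.mem_of_tendsto (f := fun n => (gmem n).toLp (g n)) (b := atTop) ?_
    (.of_forall fun n => hunif _ _ (gunif n))
  rw [tendsto_iff_norm_sub_tendsto_zero] at hlim ⊢
  refine squeeze_zero (fun n => norm_nonneg _) (fun n => ?_) hlim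
  refine Lp.norm_le_norm_of_ae_le ?_
  filter_upwards [Lp.coeFn_sub ((gmem n).toLp (g n))
      (indicatorConstLp 2 hK.measurableSet (measure_ne_top μ K) (1 : ℝ)),
    Lp.coeFn_sub (indicatorConstLp 2 (hth n) (measure_ne_top μ _) (1 : ℝ))
      (indicatorConstLp 2 hK.measurableSet (measure_ne_top μ K) (1 : ℝ)),
    (gmem n).coeFn_toLp,
    indicatorConstLp_coeFn (p := 2) (hs := hK.measurableSet) (hμs := measure_ne_top μ K)
      (c := (1 : ℝ)),
    indicatorConstLp_coeFn (p := 2) (hs := hth n) (hμs := measure_ne_top μ _)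
      (c := (1 : ℝ))] with x h1 h2 h3 h4 h5
  rw [h1, h2, Pi.sub_apply, Pi.sub_apply, h3, h4, h5]
  by_cases hxK : x ∈ K
  · have : g n x = 1 := congrArg NNReal.toReal (thickenedIndicator_one (δpos n) K hxK)
    simp [hxK, hsub n hxK, this]
  · by_cases hxt : x ∈ Metric.thickening (δ n) K
    · simpa [hxK, hxt, abs_of_nonneg (gnonneg n x)] using gle n x
    · have : g n x = 0 := congrArg NNReal.toReal (thickenedIndicator_zero (δpos n) K hxt)
      simp [hxK, hxt, this]

/-- A closed set of `L²` functions containing all bounded uniformly continuous functions contains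
the indicators of measurable sets. -/
theorem indicatorConstLp_mem_of_measurableSet {D : Set (Lp ℝ 2 μ)} (hD : IsClosed D)
    (hunif : ∀ (g : X → ℝ) (hg : MemLp g 2 μ), UniformContinuous g → hg.toLp g ∈ D)
    {S : Set X} (hS : MeasurableSet S) :
    indicatorConstLp 2 hS (measure_ne_top μ S) (1 : ℝ) ∈ D := by
  have hex : ∀ n : ℕ, ∃ K ⊆ S, IsClosed K ∧ μ (S \ K) < (n : ENNReal)⁻¹ := fun n =>
    hS.exists_isClosed_sdiff_lt (measure_ne_top μ S) (by simp)
  choose K hKS hK hμK using hex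
  refine hD.mem_of_tendsto
    (f := fun n => indicatorConstLp 2 (hK n).measurableSet (measure_ne_top μ (K n)) (1 : ℝ))
    (b := atTop) ?_ (.of_forall fun n => indicatorConstLp_mem_of_isClosed hD hunif (hK n))
  refine tendsto_indicatorConstLp_set (by simp) ?_
  refine tendsto_of_tendsto_of_tendsto_of_le_of_le tendsto_const_nhds
    ENNReal.tendsto_inv_nat_nhds_zero (fun n => zero_le) fun n => ?_
  rw [symmDiff_of_le (hKS n)]
  exact (hμK n).le

/-- If orbits of `R`-related points are forward asymptotic, then every `T`-invariant measurable set
agrees almost everywhere with a level set of a function that is constant along `R`. -/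
theorem exists_invariant_ae_eq_indicator {T : X → X} (hT : MeasurePreserving T μ μ)
    {R : X → X → Prop}
    (hR : ∀ x y, R x y → Tendsto (fun n : ℕ => dist (T^[n] x) (T^[n] y)) atTop (𝓝 0))
    {S : Set X} (hS : MeasurableSet S) (hTS : T ⁻¹' S = S) :
    ∃ F : X → ℝ, (∀ x y, R x y → F x = F y) ∧ F =ᵐ[μ] S.indicator fun _ => 1 := by
  let U : Lp ℝ 2 μ →L[ℝ] Lp ℝ 2 μ :=
    (Lp.compMeasurePreservingₗᵢ ℝ T hT : Lp ℝ 2 μ →ₗᵢ[ℝ] Lp ℝ 2 μ).toContinuousLinearMap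
  have hU : ‖U‖ ≤ 1 := LinearIsometry.norm_toContinuousLinearMap_le _
  let P := (U.eqLocus (1 : Lp ℝ 2 μ →L[ℝ] Lp ℝ 2 μ)).orthogonalProjectionOnto
  let D : Set (Lp ℝ 2 μ) :=
    {q | ∃ F : X → ℝ, (∀ x y, R x y → F x = F y) ∧ F =ᵐ[μ] (P q : Lp ℝ 2 μ)}
  have hD : IsClosed D := by
    refine IsSeqClosed.isClosed fun q q₀ hq hlim => ?_
    choose F hFR hF using hq
    have hP : Tendsto (fun n => (P (q n) : Lp ℝ 2 μ)) atTop (𝓝 (P q₀)) :=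
      ((continuous_subtype_val.comp P.continuous).tendsto q₀).comp hlim
    exact exists_invariant_ae_eq_of_tendstoInMeasure
      ((tendstoInMeasure_of_tendsto_Lp hP).congr (fun n => (hF n).symm) (ae_eq_refl _))
      fun x y hxy => by simp [hFR _ x y hxy]
  have hunif : ∀ (g : X → ℝ) (hg : MemLp g 2 μ), UniformContinuous g → hg.toLp g ∈ D := by
    intro g hg hgu
    exact exists_invariant_ae_eq_of_tendstoInMeasure
      ((tendstoInMeasure_of_tendsto_Lp
        (U.tendsto_birkhoffAverage_orthogonalProjection hU (hg.toLp g))).congr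
        (fun n => birkhoffAverage_compMeasurePreserving_toLp_ae_eq hT hg n) (ae_eq_refl _))
      fun x y hxy => tendsto_birkhoffAverage_sub_of_tendsto_dist hgu (hR x y hxy)
  obtain ⟨F, hFR, hF⟩ := indicatorConstLp_mem_of_measurableSet hD hunif hS
  refine ⟨F, hFR, hF.trans ?_⟩
  have hfix : indicatorConstLp 2 hS (measure_ne_top μ S) (1 : ℝ) ∈
      U.eqLocus (1 : Lp ℝ 2 μ →L[ℝ] Lp ℝ 2 μ) := by
    change Lp.compMeasurePreserving T hT (indicatorConstLp 2 hS (measure_ne_top μ S) (1 : ℝ)) = _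
    rw [Lp.indicatorConstLp_compMeasurePreserving]
    simp only [hTS]
    rfl
  have hPS := Submodule.orthogonalProjectionOnto_mem_subspace_eq_self
    (K := U.eqLocus (1 : Lp ℝ 2 μ →L[ℝ] Lp ℝ 2 μ)) ⟨_, hfix⟩
  have : (P (indicatorConstLp 2 hS (measure_ne_top μ S) (1 : ℝ)) : Lp ℝ 2 μ) =
      indicatorConstLp 2 hS (measure_ne_top μ S) (1 : ℝ) := congrArg Subtype.val hPS
  rw [this]
  exact indicatorConstLp_coeFn

end Density

/-- Hopf argument for pseudo-Markov systems: a finite invariant measure with stable and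
unstable relations contracting under the dynamics, and satisfying the pseudo-Markov
(local product) property, is ergodic. -/
theorem hopf_argument_pseudoMarkov {X : Type*} [MetricSpace X]
    [TopologicalSpace.SeparableSpace X] [CompleteSpace X]
    [MeasurableSpace X] [BorelSpace X]
    (γ : X ≃ₜ X) (μ : Measure X) [IsFiniteMeasure μ]
    (hinv : μ.map γ = μ)
    (Rp Rm : X → X → Prop)
    (h1 : ∀ f g : X, Rp f g →
      Tendsto (fun n : ℕ => dist ((⇑γ)^[n] f) ((⇑γ)^[n] g)) atTop (nhds 0))
    (h2 : ∀ f g : X, Rm f g →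
      Tendsto (fun n : ℕ => dist ((⇑γ.symm)^[n] f) ((⇑γ.symm)^[n] g)) atTop (nhds 0))
    (h3 : ∀ E : Set X, MeasurableSet E → μ Eᶜ = 0 →
      (μ.prod μ) {p : X × X | ¬ ∃ h ∈ E, Rp p.1 h ∧ Rm h p.2} = 0)
    (S : Set X) (hS : MeasurableSet S) (hSinv : (⇑γ) ⁻¹' S = S) :
    μ S = 0 ∨ μ Sᶜ = 0 := by
  have hγ : MeasurePreserving γ μ μ := ⟨γ.continuous.measurable, hinv⟩
  have hγ' : MeasurePreserving γ.symm μ μ := hγ.symm γ.toMeasurableEquiv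
  have hSinv' : γ.symm ⁻¹' S = S := by
    conv_lhs => rw [← hSinv]
    ext x
    simp
  obtain ⟨Fp, hFp, hFpS⟩ := exists_invariant_ae_eq_indicator hγ h1 hS hSinv
  obtain ⟨Fm, hFm, hFmS⟩ := exists_invariant_ae_eq_indicator hγ' h2 hS hSinv'
  have hgood : ∀ᵐ x ∂μ, Fp x = S.indicator (fun _ => 1) x ∧ Fm x = S.indicator (fun _ => 1) x :=
    hFpS.and hFmS
  obtain ⟨N, hN, hNmeas, hN0⟩ := exists_measurable_superset_of_null (ae_iff.1 hgood)
  have hE : ∀ x, x ∉ N →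
      Fp x = S.indicator (fun _ => 1) x ∧ Fm x = S.indicator (fun _ => 1) x := fun x hx => by
    by_contra hx'
    exact hx (hN hx')
  have hprod : (μ.prod μ) ((S ∩ Nᶜ) ×ˢ (Sᶜ ∩ Nᶜ)) = 0 := by
    refine measure_mono_null ?_ (h3 Nᶜ hNmeas.compl (by rwa [compl_compl]))
    rintro ⟨f, g⟩ ⟨⟨hfS, hfN⟩, hgS, hgN⟩ ⟨h, hhN, hfh, hhg⟩
    have hf := (hE f hfN).1
    have hg := (hE g hgN).2
    rw [indicator_of_mem hfS, hFp f h hfh, (hE h hhN).1] at hf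
    rw [indicator_of_notMem hgS, ← hFm h g hhg, (hE h hhN).2, hf] at hg
    exact one_ne_zero hg
  have hdrop : ∀ A : Set X, μ (A ∩ Nᶜ) = μ A := fun A =>
    measure_inter_conull (by rwa [compl_compl])
  rwa [Measure.prod_prod, hdrop, hdrop, mul_eq_zero] at hprod
end
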